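/- arXiv:1804.06951 — 4 statements merged into one kernel-verified Lean document; each statement's English description precedes it below -/
import Mathlib

section
/- Every atypical weight in X+ρ is W-conjugate to one of the weights λ_{k,n}: if λ ∈ X+ρ and B(λ, β) = 0 for some β ∈ {δ+ε₁, δ−ε₁, δ+ε₂, δ−ε₂, δ+ε₃, δ−ε₃}, then there exist k, n ∈ ℕ and w ∈ W such that wλ = λ_{k,n}. -/
noncomputable section

/-- The weight space of the exceptional Lie superalgebra `G(3)`. -/
abbrev V : Type := ℚ × ℚ × ℚ

def δ : V := (1, 0, 0)
def ε₁ : V := (0, 1, 0)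
def ε₂ : V := (0, 0, 1)
def ε₃ : V := -ε₁ - ε₂

/-- The symmetric bilinear form on `V` determined by `B(δ,δ) = -2`, `B(δ,εᵢ) = 0`,
`B(εᵢ,εᵢ) = 2` and `B(εᵢ,εⱼ) = -1` for `i ≠ j` (with `ε₃ = -ε₁-ε₂`). -/
def B (u v : V) : ℚ :=
  -2 * u.1 * v.1 + 2 * u.2.1 * v.2.1 + 2 * u.2.2 * v.2.2 - u.2.1 * v.2.2 - u.2.2 * v.2.1

/-- `s₀ : δ ↦ -δ, ε₁ ↦ ε₁, ε₂ ↦ ε₂`. -/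
def s₀ : V ≃ₗ[ℚ] V where
  toFun v := (-v.1, v.2.1, v.2.2)
  invFun v := (-v.1, v.2.1, v.2.2)
  map_add' a b := by
    simp only [Prod.ext_iff, Prod.fst_add, Prod.snd_add]
    refine ⟨by ring, by trivial, by trivial⟩
  map_smul' c a := by
    simp only [Prod.ext_iff, Prod.smul_fst, Prod.smul_snd, smul_eq_mul, RingHom.id_apply]
    refine ⟨by ring, by trivial, by trivial⟩
  left_inv v := by simp
  right_inv v := by simp

/-- `s₁ : δ ↦ δ, ε₁ ↦ ε₂, ε₂ ↦ ε₁`. -/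
def s₁ : V ≃ₗ[ℚ] V where
  toFun v := (v.1, v.2.2, v.2.1)
  invFun v := (v.1, v.2.2, v.2.1)
  map_add' a b := by
    simp only [Prod.ext_iff, Prod.fst_add, Prod.snd_add]
    refine ⟨by trivial, by trivial, by trivial⟩
  map_smul' c a := by
    simp only [Prod.ext_iff, Prod.smul_fst, Prod.smul_snd, smul_eq_mul, RingHom.id_apply]
    refine ⟨by trivial, by trivial, by trivial⟩
  left_inv v := by simp
  right_inv v := by simp

/-- `s₂ : δ ↦ δ, ε₁ ↦ -ε₁, ε₂ ↦ ε₁ + ε₂`. -/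
def s₂ : V ≃ₗ[ℚ] V where
  toFun v := (v.1, v.2.2 - v.2.1, v.2.2)
  invFun v := (v.1, v.2.2 - v.2.1, v.2.2)
  map_add' a b := by
    simp only [Prod.ext_iff, Prod.fst_add, Prod.snd_add]
    refine ⟨by trivial, by ring, by trivial⟩
  map_smul' c a := by
    simp only [Prod.ext_iff, Prod.smul_fst, Prod.smul_snd, smul_eq_mul, RingHom.id_apply]
    refine ⟨by trivial, by ring, by trivial⟩
  left_inv v := by
    obtain ⟨a, b, c⟩ := v
    simp only [Prod.mk.injEq]
    norm_num
  right_inv v := by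
    obtain ⟨a, b, c⟩ := v
    simp only [Prod.mk.injEq]
    norm_num

/-- The integral Weyl group `W = ⟨s₀, s₁, s₂⟩` of `G(3)`. -/
def W : Subgroup (V ≃ₗ[ℚ] V) := Subgroup.closure {s₀, s₁, s₂}

/-- The set of positive even roots of `G(3)`. -/
def Φ₀ : Set V := {(2:ℚ) • δ, ε₁, ε₂, -ε₃, ε₂ - ε₁, ε₁ - ε₃, ε₂ - ε₃}

/-- The positive even roots, as a finite set. -/
def Φ₀F : Finset V := {(2:ℚ) • δ, ε₁, ε₂, -ε₃, ε₂ - ε₁, ε₁ - ε₃, ε₂ - ε₃}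

/-- The positive odd roots, as a finite set. -/
def Φ₁F : Finset V := {δ, δ + ε₁, δ - ε₁, δ + ε₂, δ - ε₂, δ + ε₃, δ - ε₃}

/-- The isotropic positive odd roots of `G(3)`. -/
def oddIso : Set V := {δ + ε₁, δ - ε₁, δ + ε₂, δ - ε₂, δ + ε₃, δ - ε₃}

/-- The `ρ`-shifted integral weight lattice `X + ρ`. -/
def Xρ : Set V :=
  {v : V | ∃ (m c₁ c₂ : ℤ), v = ((m : ℚ) + 1/2) • δ + (c₁ : ℚ) • ε₁ + (c₂ : ℚ) • ε₂}

/-- The symbol `[d | x, y, z]` of a weight `λ`. -/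
def symb (v : V) : ℚ × ℚ × ℚ × ℚ := (-(B v δ)/2, B v ε₁/2, B v ε₂/2, B v ε₃/2)

/-- The set of symbols `𝔖ymb`. -/
def Symb : Set (ℚ × ℚ × ℚ × ℚ) :=
  {s | (∃ m : ℤ, s.1 = (m : ℚ) + 1/2) ∧ (∃ m : ℤ, 2 * s.2.1 = (m : ℚ)) ∧
       (∃ m : ℤ, 2 * s.2.2.1 = (m : ℚ)) ∧ s.2.2.2 = -s.2.1 - s.2.2.1 ∧
       (∃ m : ℤ, 2 * (s.2.2.1 - s.2.1) / 3 = (m : ℚ))}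

/-- The fundamental weight `ω₁` of `G₂`. -/
def ω₁ : V := ε₁ + (2:ℚ) • ε₂

/-- The fundamental weight `ω₂` of `G₂`. -/
def ω₂ : V := ε₁ + ε₂

/-- The inverse of the symbol map. -/
def Ψinv (s : ℚ × ℚ × ℚ × ℚ) : V :=
  s.1 • δ + (2 * (s.2.2.1 - s.2.1) / 3) • ω₁ + (2 * s.2.1) • ω₂

/-- The atypical anti-dominant weights `λ_{k,n}`. -/
def lam (k n : ℕ) : V :=
  if n < k then
    (-((2*(n:ℚ)+1)/2)) • δ - ((n:ℚ)+(k:ℚ)+1) • ε₁ - (2*(k:ℚ)+1) • ε₂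
  else if n = k then
    (-((2*(k:ℚ)+1)/2)) • δ - (2*(k:ℚ)+1) • ε₁ - (2*(k:ℚ)+1) • ε₂
  else if n ≤ 3*k then
    (-((2*(n:ℚ)+1)/2)) • δ - (2*(k:ℚ)+1) • ε₁ - ((n:ℚ)+(k:ℚ)+1) • ε₂
  else if n = 3*k+1 then
    (-((6*(k:ℚ)+3)/2)) • δ - (2*(k:ℚ)+1) • ε₁ - (4*(k:ℚ)+2) • ε₂
  else
    (-((2*(n:ℚ)+1)/2)) • δ - ((n:ℚ)-(k:ℚ)) • ε₁ - ((n:ℚ)+(k:ℚ)+1) • ε₂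

/-- The atypical anti-dominant symbols `f_{k,n}`. -/
def fsym (k n : ℕ) : ℚ × ℚ × ℚ × ℚ :=
  if n < k then
    (-(2*(n:ℚ)+1)/2, -(2*(n:ℚ)+1)/2, ((n:ℚ)-3*(k:ℚ)-1)/2, (3*(k:ℚ)+(n:ℚ)+2)/2)
  else if n = k then
    (-(2*(k:ℚ)+1)/2, -(2*(k:ℚ)+1)/2, -(2*(k:ℚ)+1)/2, 2*(k:ℚ)+1)
  else if n ≤ 3*k then
    (-(2*(n:ℚ)+1)/2, ((n:ℚ)-3*(k:ℚ)-1)/2, -(2*(n:ℚ)+1)/2, (3*(k:ℚ)+(n:ℚ)+2)/2)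
  else if n = 3*k+1 then
    (-(3*(2*(k:ℚ)+1))/2, 0, -(3*(2*(k:ℚ)+1))/2, 3*(2*(k:ℚ)+1)/2)
  else
    (-(2*(n:ℚ)+1)/2, -((n:ℚ)-3*(k:ℚ)-1)/2, -(3*(k:ℚ)+(n:ℚ)+2)/2, (2*(n:ℚ)+1)/2)

/-- The Weyl vector `ρ` of `G(3)`. -/
def ρ : V := (-(5/2) : ℚ) • δ + (2:ℚ) • ε₁ + (3:ℚ) • ε₂

/-- The weight `v` is `W`-conjugate to some `lam k n`. -/
def ConjLam (v : V) : Prop :=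
  ∃ (k n : ℕ) (w : V ≃ₗ[ℚ] V), w ∈ W ∧ w v = lam k n

theorem ConjLam.of_apply {g : V ≃ₗ[ℚ] V} (hg : g ∈ W) {v : V} (h : ConjLam (g v)) :
    ConjLam v := by
  obtain ⟨k, n, w, hw, e⟩ := h
  exact ⟨k, n, w * g, W.mul_mem hw hg, e⟩

theorem ConjLam.of_s₀ {d a b : ℚ} (h : ConjLam (-d, a, b)) : ConjLam (d, a, b) :=
  ConjLam.of_apply (g := s₀) (Subgroup.subset_closure (by simp)) h

theorem ConjLam.of_s₁ {d a b : ℚ} (h : ConjLam (d, b, a)) : ConjLam (d, a, b) :=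
  ConjLam.of_apply (g := s₁) (Subgroup.subset_closure (by simp)) h

theorem ConjLam.of_s₂ {d a b : ℚ} (h : ConjLam (d, b - a, b)) : ConjLam (d, a, b) :=
  ConjLam.of_apply (g := s₂) (Subgroup.subset_closure (by simp)) h

theorem conjLam_of_eq_lam {d a b : ℚ} (k n : ℕ) (h : (d, a, b) = lam k n) :
    ConjLam (d, a, b) :=
  ⟨k, n, 1, W.one_mem, h⟩

theorem conjLam_normal_form (k n : ℕ) :
    ConjLam (-((n : ℚ) + 1 / 2), -((n : ℚ) + k + 1), -(2 * (k : ℚ) + 1)) := by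
  rcases lt_trichotomy n k with h | rfl | h
  · apply conjLam_of_eq_lam k n
    simp only [lam, if_pos h, δ, ε₁, ε₂, Prod.ext_iff]
    refine ⟨?_, ?_, ?_⟩ <;> simp <;> ring
  · apply conjLam_of_eq_lam n n
    simp only [lam, lt_irrefl, if_false, if_true, δ, ε₁, ε₂, Prod.ext_iff]
    refine ⟨?_, ?_, ?_⟩ <;> simp <;> ring
  · apply ConjLam.of_s₁
    have h₁ : ¬ n < k := by omega
    have h₂ : n ≠ k := by omega
    by_cases h₃ : n ≤ 3 * k
    · apply conjLam_of_eq_lam k n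
      simp only [lam, if_neg h₁, if_neg h₂, if_pos h₃, δ, ε₁, ε₂, Prod.ext_iff]
      refine ⟨?_, ?_, ?_⟩ <;> simp <;> ring
    by_cases h₄ : n = 3 * k + 1
    · apply conjLam_of_eq_lam k n
      simp only [lam, if_neg h₁, if_neg h₂, if_neg h₃, if_pos h₄, δ, ε₁, ε₂, Prod.ext_iff]
      have hn : (n : ℚ) = 3 * k + 1 := by exact_mod_cast h₄
      refine ⟨?_, ?_, ?_⟩ <;> simp [hn] <;> ring
    · apply ConjLam.of_s₂
      apply conjLam_of_eq_lam k n
      simp only [lam, if_neg h₁, if_neg h₂, if_neg h₃, if_neg h₄, δ, ε₁, ε₂, Prod.ext_iff]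
      refine ⟨?_, ?_, ?_⟩ <;> simp <;> ring

theorem conjLam_of_orthogonal_of_neg (n : ℕ) {a b : ℤ} (h : 2 * a - b = -(2 * n + 1))
    (hb : b < 0) : ConjLam (-((n : ℚ) + 1 / 2), (a : ℚ), (b : ℚ)) := by
  obtain ⟨k, hk⟩ := Int.eq_ofNat_of_zero_le (a := -a - n - 1) (by omega)
  have ha : a = -(n + k + 1) := by omega
  have hb' : b = -(2 * k + 1) := by omega
  subst ha hb'
  simpa using conjLam_normal_form k n

theorem conjLam_of_orthogonal (n : ℕ) {a b : ℤ} (h : 2 * a - b = -(2 * n + 1)) :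
    ConjLam (-((n : ℚ) + 1 / 2), (a : ℚ), (b : ℚ)) := by
  rcases lt_or_ge b 0 with hb | hb
  · exact conjLam_of_orthogonal_of_neg n h hb
  -- The word `s₁ s₂ s₁ s₂ s₁` is the reflection `(a, b) ↦ (a - b, -b)`.
  · apply ConjLam.of_s₁
    apply ConjLam.of_s₂
    apply ConjLam.of_s₁
    apply ConjLam.of_s₂
    apply ConjLam.of_s₁
    have := conjLam_of_orthogonal_of_neg n (a := a - b) (b := -b) (by omega) (by omega)
    simpa using this

theorem conjLam_of_atypical (n : ℕ) (a b : ℤ)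
    (h : 2 * a - b = -(2 * n + 1) ∨ 2 * a - b = 2 * n + 1 ∨
      2 * b - a = -(2 * n + 1) ∨ 2 * b - a = 2 * n + 1 ∨
      a + b = -(2 * n + 1) ∨ a + b = 2 * n + 1) :
    ConjLam (-((n : ℚ) + 1 / 2), (a : ℚ), (b : ℚ)) := by
  rcases h with h | h | h | h | h | h
  · exact conjLam_of_orthogonal n h
  · apply ConjLam.of_s₂
    exact_mod_cast conjLam_of_orthogonal n (a := b - a) (b := b) (by omega)
  · apply ConjLam.of_s₁
    exact conjLam_of_orthogonal n h
  · apply ConjLam.of_s₁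
    apply ConjLam.of_s₂
    exact_mod_cast conjLam_of_orthogonal n (a := a - b) (b := a) (by omega)
  · apply ConjLam.of_s₂
    apply ConjLam.of_s₁
    exact_mod_cast conjLam_of_orthogonal n (a := b) (b := b - a) (by omega)
  · apply ConjLam.of_s₂
    apply ConjLam.of_s₁
    apply ConjLam.of_s₂
    exact_mod_cast conjLam_of_orthogonal n (a := b - a - b) (b := b - a) (by omega)

theorem atypical_cases {m a b : ℤ} {β : V} (hβ : β ∈ oddIso)
    (h : B ((m : ℚ) + 1 / 2, (a : ℚ), (b : ℚ)) β = 0) :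
    2 * a - b = -(2 * m + 1) ∨ 2 * a - b = 2 * m + 1 ∨
      2 * b - a = -(2 * m + 1) ∨ 2 * b - a = 2 * m + 1 ∨
      a + b = -(2 * m + 1) ∨ a + b = 2 * m + 1 := by
  simp only [oddIso, Set.mem_insert_iff, Set.mem_singleton_iff] at hβ
  qify
  rcases hβ with rfl | rfl | rfl | rfl | rfl | rfl <;>
    simp [B, δ, ε₁, ε₂, ε₃] at h
  · right; left; linarith
  · left; linarith
  · right; right; right; left; linarith
  · right; right; left; linarith
  · right; right; right; right; left; linarith
  · right; right; right; right; right; linarith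

/-- Every atypical weight in `X+ρ` is `W`-conjugate to one of the weights `λ_{k,n}`. -/
theorem atypical_weight_conjugate_lam (v : V) (hv : v ∈ Xρ)
    (hatyp : ∃ β ∈ oddIso, B v β = 0) :
    ∃ (k n : ℕ) (w : V ≃ₗ[ℚ] V), w ∈ W ∧ w v = lam k n := by
  obtain ⟨m, a, b, rfl⟩ := hv
  obtain ⟨β, hβ, h⟩ := hatyp
  have hcoord : ((m : ℚ) + 1 / 2) • δ + (a : ℚ) • ε₁ + (b : ℚ) • ε₂ =
      ((m : ℚ) + 1 / 2, (a : ℚ), (b : ℚ)) := by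
    simp [δ, ε₁, ε₂]
  rw [hcoord] at h ⊢
  have hcases := atypical_cases hβ h
  change ConjLam _
  rcases le_or_gt 0 m with hm | hm
  · obtain ⟨n, rfl⟩ := Int.eq_ofNat_of_zero_le hm
    apply ConjLam.of_s₀
    exact_mod_cast conjLam_of_atypical n a b hcases
  · obtain ⟨n, hn⟩ := Int.eq_ofNat_of_zero_le (a := -m - 1) (by omega)
    obtain rfl : m = -n - 1 := by omega
    have := conjLam_of_atypical n a b (by omega)
    convert this using 2
    push_cast
    ring
end
end

section
/- For every k ∈ ℕ, the stabilizer of λ_{k,k} in W is exactly {1, s₁}, and the stabilizer of λ_{k,3k+1} in W is exactly {1, s₂}; in particular both stabilizers have order 2, with s₁λ_{k,k} = λ_{k,k} and s₂λ_{k,3k+1} = λ_{k,3k+1}. -/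
noncomputable section

lemma s₀_apply (v : V) : s₀ v = (-v.1, v.2.1, v.2.2) := rfl

lemma s₁_apply (v : V) : s₁ v = (v.1, v.2.2, v.2.1) := rfl

lemma s₂_apply (v : V) : s₂ v = (v.1, v.2.2 - v.2.1, v.2.2) := rfl

/-- A property of vectors preserved by the three generators is preserved by all of `W`. -/
lemma W_preserves {P : V → Prop} (h₀ : ∀ v, P v → P (s₀ v)) (h₁ : ∀ v, P v → P (s₁ v))
    (h₂ : ∀ v, P v → P (s₂ v)) {w : V ≃ₗ[ℚ] V} (hw : w ∈ W) {v : V} (hv : P v) : P (w v) := by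
  have hinv : s₀⁻¹ = s₀ ∧ s₁⁻¹ = s₁ ∧ s₂⁻¹ = s₂ := ⟨rfl, rfl, rfl⟩
  induction hw using Subgroup.closure_induction_left with
  | one => exact hv
  | mul_left x hx y _ ih =>
    rcases hx with rfl | rfl | rfl
    exacts [h₀ _ ih, h₁ _ ih, h₂ _ ih]
  | inv_mul_cancel x hx y _ ih =>
    rcases hx with rfl | rfl | rfl
    · rw [hinv.1]; exact h₀ _ ih
    · rw [hinv.2.1]; exact h₁ _ ih
    · rw [hinv.2.2]; exact h₂ _ ih

/-- The short roots of `G₂`: the integral vectors of norm one in the span of `ε₁, ε₂`. -/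
def IsShortRoot (v : V) : Prop :=
  ∃ a c : ℤ, v = (0, (a : ℚ), (c : ℚ)) ∧ a ^ 2 - a * c + c ^ 2 = 1

lemma IsShortRoot.map {w : V ≃ₗ[ℚ] V} (hw : w ∈ W) {v : V} (hv : IsShortRoot v) :
    IsShortRoot (w v) := by
  refine W_preserves ?_ ?_ ?_ hw hv
  · rintro _ ⟨a, c, rfl, h⟩
    exact ⟨a, c, by simp [s₀_apply], h⟩
  · rintro _ ⟨a, c, rfl, h⟩
    exact ⟨c, a, by simp [s₁_apply], by linarith⟩
  · rintro _ ⟨a, c, rfl, h⟩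
    exact ⟨c - a, c, by simp [s₂_apply], by linarith⟩

lemma W_map_δ {w : V ≃ₗ[ℚ] V} (hw : w ∈ W) : w δ = δ ∨ w δ = -δ := by
  refine W_preserves (P := fun v => v = δ ∨ v = -δ) ?_ ?_ ?_ hw (Or.inl rfl) <;>
  · rintro _ (rfl | rfl) <;> simp [s₀_apply, s₁_apply, s₂_apply, δ]

lemma shortRoot_coord_bounds {a c : ℤ} (h : a ^ 2 - a * c + c ^ 2 = 1) :
    (-1 ≤ a ∧ a ≤ 1) ∧ -1 ≤ c ∧ c ≤ 1 := by
  refine ⟨⟨?_, ?_⟩, ?_, ?_⟩ <;> nlinarith [sq_nonneg (2 * c - a), sq_nonneg (2 * a - c)]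

lemma eq_smul_basis (v : V) : v = v.1 • δ + v.2.1 • ε₁ + v.2.2 • ε₂ := by
  simp [δ, ε₁, ε₂]

lemma linearEquiv_ext_basis {f g : V ≃ₗ[ℚ] V} (hδ : f δ = g δ) (h₁ : f ε₁ = g ε₁)
    (h₂ : f ε₂ = g ε₂) : f = g := by
  ext1 v
  rw [eq_smul_basis v]
  simp only [map_add, map_smul, hδ, h₁, h₂]

/-- An element of `W` fixing a vector with nonzero `δ`-coordinate fixes `δ`, and acts on
`ε₁, ε₂` by an integral matrix with columns `(a, c)`, `(b, d)` of norm one. -/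
lemma exists_matrix_of_fixed {w : V ≃ₗ[ℚ] V} (hw : w ∈ W) {x y z : ℚ} (hx : x ≠ 0)
    (h : w (x, y, z) = (x, y, z)) :
    w δ = δ ∧ ∃ a b c d : ℤ, w ε₁ = (0, (a : ℚ), (c : ℚ)) ∧ w ε₂ = (0, (b : ℚ), (d : ℚ)) ∧
      a ^ 2 - a * c + c ^ 2 = 1 ∧ b ^ 2 - b * d + d ^ 2 = 1 ∧
      a * y + b * z = y ∧ c * y + d * z = z := by
  obtain ⟨a, c, h₁, hac⟩ := IsShortRoot.map hw (v := ε₁) ⟨1, 0, by simp [ε₁], by norm_num⟩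
  obtain ⟨b, d, h₂, hbd⟩ := IsShortRoot.map hw (v := ε₂) ⟨0, 1, by simp [ε₂], by norm_num⟩
  rw [eq_smul_basis (x, y, z)] at h
  simp only [map_add, map_smul, h₁, h₂] at h
  rcases W_map_δ hw with hδ | hδ
  · refine ⟨hδ, a, b, c, d, h₁, h₂, hac, hbd, ?_⟩
    rw [hδ] at h
    simp [δ, ε₁, ε₂] at h
    exact ⟨by linarith [h.1], by linarith [h.2]⟩
  · rw [hδ] at h
    simp [δ, ε₁, ε₂] at h
    exact absurd (by linarith [h.1]) hx

lemma eq_one_or_s₁_of_fixed {w : V ≃ₗ[ℚ] V} (hw : w ∈ W) {x y : ℚ} (hx : x ≠ 0) (hy : y ≠ 0)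
    (h : w (x, y, y) = (x, y, y)) : w = 1 ∨ w = s₁ := by
  obtain ⟨hδ, a, b, c, d, h₁, h₂, hac, hbd, hab, hcd⟩ := exists_matrix_of_fixed hw hx h
  have hb : a + b = 1 := by
    have : ((a : ℚ) + b) = 1 := mul_right_cancel₀ hy (by linarith)
    exact_mod_cast this
  have hd : c + d = 1 := by
    have : ((c : ℚ) + d) = 1 := mul_right_cancel₀ hy (by linarith)
    exact_mod_cast this
  obtain rfl : b = 1 - a := by linarith
  obtain rfl : d = 1 - c := by linarith
  have hcases : (a = 1 ∧ c = 0) ∨ (a = 0 ∧ c = 1) := by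
    obtain ⟨⟨ha, ha'⟩, hc, hc'⟩ := shortRoot_coord_bounds hac
    interval_cases a <;> interval_cases c <;> simp_all
  rcases hcases with ⟨rfl, rfl⟩ | ⟨rfl, rfl⟩
  · left
    refine linearEquiv_ext_basis hδ (h₁.trans ?_) (h₂.trans ?_) <;> simp [ε₁, ε₂]
  · right
    refine linearEquiv_ext_basis hδ (h₁.trans ?_) (h₂.trans ?_) <;> simp [s₁_apply, ε₁, ε₂]

lemma eq_one_or_s₂_of_fixed {w : V ≃ₗ[ℚ] V} (hw : w ∈ W) {x y : ℚ} (hx : x ≠ 0) (hy : y ≠ 0)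
    (h : w (x, y, 2 * y) = (x, y, 2 * y)) : w = 1 ∨ w = s₂ := by
  obtain ⟨hδ, a, b, c, d, h₁, h₂, hac, hbd, hab, hcd⟩ := exists_matrix_of_fixed hw hx h
  have ha : a + 2 * b = 1 := by
    have : ((a : ℚ) + 2 * b) = 1 := mul_right_cancel₀ hy (by linarith)
    exact_mod_cast this
  have hc : c + 2 * d = 2 := by
    have : ((c : ℚ) + 2 * d) = 2 := mul_right_cancel₀ hy (by linarith)
    exact_mod_cast this
  obtain rfl : a = 1 - 2 * b := by linarith
  obtain rfl : c = 2 - 2 * d := by linarith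
  have hcases : (b = 0 ∧ d = 1) ∨ (b = 1 ∧ d = 1) := by
    obtain ⟨⟨hb, hb'⟩, hd, hd'⟩ := shortRoot_coord_bounds hbd
    interval_cases b <;> interval_cases d <;> simp_all
  rcases hcases with ⟨rfl, rfl⟩ | ⟨rfl, rfl⟩
  · left
    refine linearEquiv_ext_basis hδ (h₁.trans ?_) (h₂.trans ?_) <;> simp [ε₁, ε₂]
  · right
    refine linearEquiv_ext_basis (hδ.trans ?_) (h₁.trans ?_) (h₂.trans ?_) <;>
      simp [s₂_apply, δ, ε₁, ε₂]

lemma lam_self (k : ℕ) :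
    lam k k = (-((2 * (k : ℚ) + 1) / 2), -(2 * (k : ℚ) + 1), -(2 * (k : ℚ) + 1)) := by
  simp [lam, δ, ε₁, ε₂]

lemma lam_three_mul_add_one (k : ℕ) :
    lam k (3 * k + 1) =
      (-((6 * (k : ℚ) + 3) / 2), -(2 * (k : ℚ) + 1), 2 * -(2 * (k : ℚ) + 1)) := by
  have h₁ : ¬ 3 * k + 1 < k := by omega
  have h₂ : ¬ 3 * k + 1 = k := by omega
  have h₃ : ¬ 3 * k + 1 ≤ 3 * k := by omega
  rw [lam, if_neg h₁, if_neg h₂, if_neg h₃, if_pos rfl]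
  simp [δ, ε₁, ε₂]
  ring

/-- For every `k ∈ ℕ`, the stabilizer of `λ_{k,k}` in `W` is exactly `{1, s₁}` and the
stabilizer of `λ_{k,3k+1}` in `W` is exactly `{1, s₂}`; in particular both stabilizers
have order 2, with `s₁λ_{k,k} = λ_{k,k}` and `s₂λ_{k,3k+1} = λ_{k,3k+1}`. -/
theorem stabilizer_singular_weights (k : ℕ) :
    s₁ (lam k k) = lam k k ∧
    s₂ (lam k (3*k+1)) = lam k (3*k+1) ∧
    (∀ w : V ≃ₗ[ℚ] V, w ∈ W → (w (lam k k) = lam k k ↔ w = 1 ∨ w = s₁)) ∧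
    (∀ w : V ≃ₗ[ℚ] V, w ∈ W → (w (lam k (3*k+1)) = lam k (3*k+1) ↔ w = 1 ∨ w = s₂)) ∧
    s₁ ≠ 1 ∧ s₂ ≠ 1 := by
  have hk : (0 : ℚ) ≤ k := Nat.cast_nonneg k
  have hy : -(2 * (k : ℚ) + 1) ≠ 0 := by linarith
  have fix₁ : s₁ (lam k k) = lam k k := by rw [lam_self, s₁_apply]
  have fix₂ : s₂ (lam k (3*k+1)) = lam k (3*k+1) := by
    rw [lam_three_mul_add_one, s₂_apply]
    simp only [Prod.mk.injEq, true_and, and_true]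
    ring
  refine ⟨fix₁, fix₂, fun w hw => ⟨fun h => ?_, ?_⟩, fun w hw => ⟨fun h => ?_, ?_⟩, ?_, ?_⟩
  · rw [lam_self] at h
    exact eq_one_or_s₁_of_fixed hw (by linarith) hy h
  · rintro (rfl | rfl)
    exacts [rfl, fix₁]
  · rw [lam_three_mul_add_one] at h
    exact eq_one_or_s₂_of_fixed hw (by linarith) hy h
  · rintro (rfl | rfl)
    exacts [rfl, fix₂]
  · intro h
    simpa [s₁_apply, ε₁] using DFunLike.congr_fun h ε₁
  · intro h
    have := DFunLike.congr_fun h ε₁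
    norm_num [s₂_apply, ε₁] at this
end
end

section
/- For k, n ∈ ℕ with n ≠ k and n ≠ 3k+1, the weight λ_{k,n} is regular: the only element w ∈ W with wλ_{k,n} = λ_{k,n} is the identity. -/
noncomputable section

/-- `w` acts as `e` on the line of `δ` and as `s` times one of six representatives of the
Weyl group of `G₂` modulo `{1, -1}` on the plane of `ε₁, ε₂`. -/
def ActsAs (w : V ≃ₗ[ℚ] V) (e s : ℚ) : Prop :=
  (∀ a b c, w (a, b, c) = (e * a, s * b, s * c)) ∨
  (∀ a b c, w (a, b, c) = (e * a, s * c, s * b)) ∨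
  (∀ a b c, w (a, b, c) = (e * a, s * (c - b), s * c)) ∨
  (∀ a b c, w (a, b, c) = (e * a, s * b, s * (b - c))) ∨
  (∀ a b c, w (a, b, c) = (e * a, s * c, s * (c - b))) ∨
  (∀ a b c, w (a, b, c) = (e * a, s * (b - c), s * b))

theorem ActsAs.s₀_mul {w : V ≃ₗ[ℚ] V} {e s : ℚ} (h : ActsAs w e s) :
    ActsAs (s₀ * w) (-e) s := by
  have hs (v : V) : s₀ v = (-v.1, v.2.1, v.2.2) := rfl
  rcases h with h | h | h | h | h | h <;>
    simp only [ActsAs, LinearEquiv.mul_apply, h, hs, neg_mul, implies_true, true_or, or_true]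

theorem ActsAs.s₁_mul {w : V ≃ₗ[ℚ] V} {e s : ℚ} (h : ActsAs w e s) :
    ActsAs (s₁ * w) e s := by
  have hs (v : V) : s₁ v = (v.1, v.2.2, v.2.1) := rfl
  rcases h with h | h | h | h | h | h <;>
    simp only [ActsAs, LinearEquiv.mul_apply, h, hs, implies_true, true_or, or_true]

theorem ActsAs.s₂_mul {w : V ≃ₗ[ℚ] V} {e s : ℚ} (h : ActsAs w e s) :
    ActsAs (s₂ * w) e s ∨ ActsAs (s₂ * w) e (-s) := by
  have hs (v : V) : s₂ v = (v.1, v.2.2 - v.2.1, v.2.2) := rfl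
  rcases h with h | h | h | h | h | h
  · exact .inl <| .inr <| .inr <| .inl fun a b c => by
      simp only [LinearEquiv.mul_apply, h, hs]; ring_nf
  · exact .inl <| .inr <| .inr <| .inr <| .inr <| .inr fun a b c => by
      simp only [LinearEquiv.mul_apply, h, hs]; ring_nf
  · exact .inl <| .inl fun a b c => by
      simp only [LinearEquiv.mul_apply, h, hs]; ring_nf
  · exact .inr <| .inr <| .inr <| .inr <| .inr <| .inl fun a b c => by
      simp only [LinearEquiv.mul_apply, h, hs]; ring_nf
  · exact .inr <| .inr <| .inr <| .inr <| .inl fun a b c => by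
      simp only [LinearEquiv.mul_apply, h, hs]; ring_nf
  · exact .inl <| .inr <| .inl fun a b c => by
      simp only [LinearEquiv.mul_apply, h, hs]; ring_nf

theorem exists_actsAs_of_mem_W {w : V ≃ₗ[ℚ] V} (hw : w ∈ W) :
    ∃ e s : ℚ, (e = 1 ∨ e = -1) ∧ (s = 1 ∨ s = -1) ∧ ActsAs w e s := by
  have neg_unit {x : ℚ} (hx : x = 1 ∨ x = -1) : -x = 1 ∨ -x = -1 := by
    rcases hx with rfl | rfl <;> norm_num
  have mul_left (x : V ≃ₗ[ℚ] V) (hx : x ∈ ({s₀, s₁, s₂} : Set (V ≃ₗ[ℚ] V))) (y : V ≃ₗ[ℚ] V)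
      (hy : ∃ e s : ℚ, (e = 1 ∨ e = -1) ∧ (s = 1 ∨ s = -1) ∧ ActsAs y e s) :
      ∃ e s : ℚ, (e = 1 ∨ e = -1) ∧ (s = 1 ∨ s = -1) ∧ ActsAs (x * y) e s := by
    obtain ⟨e, s, he, hs, h⟩ := hy
    rcases hx with rfl | rfl | rfl
    · exact ⟨-e, s, neg_unit he, hs, h.s₀_mul⟩
    · exact ⟨e, s, he, hs, h.s₁_mul⟩
    · rcases h.s₂_mul with h | h
      · exact ⟨e, s, he, hs, h⟩
      · exact ⟨e, -s, he, neg_unit hs, h⟩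
  induction hw using Subgroup.closure_induction_left with
  | one => exact ⟨1, 1, .inl rfl, .inl rfl, .inl fun a b c => by simp⟩
  | mul_left x hx y _ ih => exact mul_left x hx y ih
  | inv_mul_cancel x hx y _ ih =>
    have hinv : x⁻¹ = x := by rcases hx with rfl | rfl | rfl <;> rfl
    rw [hinv]
    exact mul_left x hx y ih

/-- A vector off the reflecting hyperplanes of `W` has trivial stabilizer. -/
theorem eq_one_of_mem_W_of_apply_eq {w : V ≃ₗ[ℚ] V} (hw : w ∈ W) {a b c : ℚ}
    (ha : a ≠ 0) (hb : b ≠ 0) (hc : c ≠ 0) (hbc : b ≠ c) (hbc' : b + c ≠ 0)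
    (hb2 : b ≠ 2 * c) (hc2 : c ≠ 2 * b) (hfix : w (a, b, c) = (a, b, c)) : w = 1 := by
  obtain ⟨e, s, he, hs, h⟩ := exists_actsAs_of_mem_W hw
  rcases h with h | h | h | h | h | h <;> rw [h, Prod.mk.injEq, Prod.mk.injEq] at hfix <;>
    obtain ⟨h₀, h₁, h₂⟩ := hfix
  · obtain rfl : e = 1 := by simpa [ha] using h₀
    obtain rfl : s = 1 := by simpa [hb] using h₁
    ext v <;> simp [h]
  all_goals
    exfalso
    rcases hs with rfl | rfl <;> grind

/-- Coordinates of `λ_{k,n}` away from the two singular values of `n`. -/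
theorem lam_eq (k n : ℕ) (h1 : n ≠ k) (h2 : n ≠ 3*k+1) :
    lam k n = (-((2*(n:ℚ)+1)/2),
      if n < k then (-((n:ℚ)+k+1), -(2*(k:ℚ)+1))
      else if n ≤ 3*k then (-(2*(k:ℚ)+1), -((n:ℚ)+k+1))
      else (-((n:ℚ)-k), -((n:ℚ)+k+1))) := by
  unfold lam
  rw [if_neg h1, if_neg h2]
  split_ifs <;> simp [δ, ε₁, ε₂]

/-- For `k, n ∈ ℕ` with `n ≠ k` and `n ≠ 3k+1`, the weight `λ_{k,n}` is regular: the only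
element `w ∈ W` with `wλ_{k,n} = λ_{k,n}` is the identity. -/
theorem lam_regular (k n : ℕ) (h1 : n ≠ k) (h2 : n ≠ 3*k+1) :
    ∀ w : V ≃ₗ[ℚ] V, w ∈ W → w (lam k n) = lam k n → w = 1 := by
  intro w hw
  rw [lam_eq k n h1 h2]
  have hn : (0:ℚ) ≤ n := n.cast_nonneg
  have hk : (0:ℚ) ≤ k := k.cast_nonneg
  have h1' : (n:ℚ) ≠ k := by exact_mod_cast h1
  have h2' : (n:ℚ) ≠ 3*k+1 := by exact_mod_cast h2
  have ha : -((2*(n:ℚ)+1)/2) ≠ 0 := by linarith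
  split_ifs with hlt hle
  · have hlt' : (n:ℚ) < k := by exact_mod_cast hlt
    apply eq_one_of_mem_W_of_apply_eq hw ha <;> grind
  · apply eq_one_of_mem_W_of_apply_eq hw ha <;> grind
  · have hgt : 3*(k:ℚ) < n := by exact_mod_cast not_le.mp hle
    apply eq_one_of_mem_W_of_apply_eq hw ha <;> grind
end
end

section
/- For all k, n ∈ ℕ and every w ∈ W, B(wλ_{k,n} + ρ, wλ_{k,n} − ρ) = 6k² + 6k. (This is the eigenvalue of the Casimir operator of G(3) on the Verma module with highest weight wλ_{k,n} − ρ, which separates the atypical blocks 𝓑_k for different k.) -/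
noncomputable section

/-- The form `B` is invariant under the Weyl group. -/
theorem B_map_map_of_mem_W {w : V ≃ₗ[ℚ] V} (hw : w ∈ W) (u v : V) : B (w u) (w v) = B u v := by
  induction hw using Subgroup.closure_induction generalizing u v with
  | mem x hx =>
    rcases hx with rfl | rfl | rfl <;> simp [B, s₀, s₁, s₂] <;> ring
  | one => rfl
  | mul x y _ _ hx hy => exact (hx _ _).trans (hy _ _)
  | inv x _ hx =>
    rw [← hx, ← LinearEquiv.mul_apply, ← LinearEquiv.mul_apply, mul_inv_cancel]
    rfl

theorem B_add_sub (u v : V) : B (u + v) (u - v) = B u u - B v v := by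
  simp only [B, Prod.fst_add, Prod.snd_add, Prod.fst_sub, Prod.snd_sub]
  ring

theorem B_rho_rho : B ρ ρ = 3 / 2 := by
  norm_num [B, ρ, δ, ε₁, ε₂]

theorem B_lam_lam (k n : ℕ) : B (lam k n) (lam k n) = 3 / 2 * (2 * (k : ℚ) + 1) ^ 2 := by
  unfold lam
  split_ifs <;> simp [B, δ, ε₁, ε₂] <;> ring

/-- For all `k, n ∈ ℕ` and every `w ∈ W`, `B(wλ_{k,n} + ρ, wλ_{k,n} − ρ) = 6k² + 6k`:
the Casimir eigenvalue on the Verma module of highest weight `wλ_{k,n} − ρ`. -/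
theorem casimir_eigenvalue (k n : ℕ) (w : V ≃ₗ[ℚ] V) (hw : w ∈ W) :
    B (w (lam k n) + ρ) (w (lam k n) - ρ) = 6 * (k:ℚ)^2 + 6 * (k:ℚ) := by
  rw [B_add_sub, B_map_map_of_mem_W hw, B_lam_lam, B_rho_rho]
  ring
end
end
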